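/- arXiv:1506.08542 — 5 statements merged into one kernel-verified Lean document; each statement's English description precedes it below -/
import Mathlib

section
/- Let g be real with g > 1/2 and set a₊ = (1 + i√(4g² - 1))/(2g) and a₋ = (1 - i√(4g² - 1))/(2g) in ℂ. Then Re(a₊²/2 - Log(a₊/g)) = Re(a₋²/2 - Log(a₋/g)), where Log is the principal branch of the complex logarithm. Consequently the real part of the free energy N₊(a₊²/2 - Log(a₊/g)) + N₋(a₋²/2 - Log(a₋/g)) depends only on N₊ + N₋ and not on the individual filling numbers N₊, N₋. -/
open Complex

/-- The real part of the action density `a² / 2 - Log (a / g)` is invariant under complex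
conjugation of `a`. -/
theorem re_action_conj (g : ℝ) (a : ℂ) :
    ((starRingEnd ℂ a) ^ 2 / 2 - Complex.log (starRingEnd ℂ a / g)).re
      = (a ^ 2 / 2 - Complex.log (a / g)).re := by
  have hsq : (starRingEnd ℂ a) ^ 2 / 2 = starRingEnd ℂ (a ^ 2 / 2) := by
    simp [map_ofNat (starRingEnd ℂ) 2]
  have hdiv : starRingEnd ℂ a / g = starRingEnd ℂ (a / g) := by simp
  rw [hsq, hdiv, sub_re, sub_re, conj_re, log_re, log_re, norm_conj]

/-- For `g > 1/2`, with `a± = (1 ± i√(4g² - 1))/(2g)`, the real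
parts of the two on-shell action densities agree:
`Re(a₊²/2 - Log(a₊/g)) = Re(a₋²/2 - Log(a₋/g))`; consequently the real part of
`N₊(a₊²/2 - Log(a₊/g)) + N₋(a₋²/2 - Log(a₋/g))` depends only on `N₊ + N₋`. -/
theorem broken_phase_free_energy_real_part (g : ℝ) (hg : 1/2 < g) :
    let aplus : ℂ := (1 + Complex.I * (Real.sqrt (4 * g ^ 2 - 1) : ℂ)) / (2 * g)
    let aminus : ℂ := (1 - Complex.I * (Real.sqrt (4 * g ^ 2 - 1) : ℂ)) / (2 * g)
    (aplus ^ 2 / 2 - Complex.log (aplus / g)).re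
      = (aminus ^ 2 / 2 - Complex.log (aminus / g)).re ∧
    ∀ Nplus Nminus Mplus Mminus : ℕ, Nplus + Nminus = Mplus + Mminus →
      ((Nplus : ℂ) * (aplus ^ 2 / 2 - Complex.log (aplus / g))
        + (Nminus : ℂ) * (aminus ^ 2 / 2 - Complex.log (aminus / g))).re
      = ((Mplus : ℂ) * (aplus ^ 2 / 2 - Complex.log (aplus / g))
        + (Mminus : ℂ) * (aminus ^ 2 / 2 - Complex.log (aminus / g))).re := by
  intro aplus aminus
  have hconj : aminus = starRingEnd ℂ aplus := by
    simp [aplus, aminus, sub_eq_add_neg, map_ofNat (starRingEnd ℂ) 2]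
  have hre : (aplus ^ 2 / 2 - Complex.log (aplus / g)).re
      = (aminus ^ 2 / 2 - Complex.log (aminus / g)).re := by
    rw [hconj, re_action_conj]
  refine ⟨hre, fun Nplus Nminus Mplus Mminus hN => ?_⟩
  have hN' : (Nplus : ℝ) + Nminus = Mplus + Mminus := mod_cast hN
  simp only [add_re, mul_re, natCast_re, natCast_im, zero_mul, sub_zero, hre]
  rw [← add_mul, ← add_mul, hN']
end

section
/- Let g be real with 0 < g < 1/2 and set ε = 1 - 4g² ∈ (0,1), a₊ = (1 + √ε)/(2g), a₋ = (1 - √ε)/(2g). Then the mass eigenvalues satisfy the closed forms Λ₋ = 1 - a₋² = 2√ε/(1 + √ε) and Λ₊ = 1 - a₊² = -2√ε/(1 - √ε); in particular Λ₋ > 0 and Λ₊ < 0 (equivalently 0 < a₋ < 1 < a₊), so for g < 1/2 the only stable vacuum is the symmetric one with N₊ = 0. -/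
/-- For `0 < g < 1/2` and `ε = 1 - 4g² ∈ (0,1)`, with
`a± = (1 ± √ε)/(2g)`, the mass eigenvalues satisfy
`Λ₋ = 1 - a₋² = 2√ε/(1 + √ε) > 0` and `Λ₊ = 1 - a₊² = -2√ε/(1 - √ε) < 0`, and
`0 < a₋ < 1 < a₊`: for `g < 1/2` the only stable vacuum is the symmetric one. -/
theorem symmetric_phase_stability (g : ℝ) (hg : 0 < g) (hg' : g < 1/2) :
    let eps : ℝ := 1 - 4 * g ^ 2
    let aplus : ℝ := (1 + Real.sqrt eps) / (2 * g)
    let aminus : ℝ := (1 - Real.sqrt eps) / (2 * g)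
    eps ∈ Set.Ioo (0 : ℝ) 1 ∧
    1 - aminus ^ 2 = 2 * Real.sqrt eps / (1 + Real.sqrt eps) ∧
    1 - aplus ^ 2 = -(2 * Real.sqrt eps) / (1 - Real.sqrt eps) ∧
    0 < 1 - aminus ^ 2 ∧ 1 - aplus ^ 2 < 0 ∧
    0 < aminus ∧ aminus < 1 ∧ 1 < aplus := by
  intro eps aplus aminus
  have heps : eps ∈ Set.Ioo (0 : ℝ) 1 := by
    constructor <;> simp only [eps] <;> nlinarith
  have hs0 : 0 < √eps := Real.sqrt_pos.2 heps.1
  have hsq : √eps ^ 2 = 1 - 4 * g ^ 2 := Real.sq_sqrt heps.1.le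
  have hs1 : √eps < 1 := by nlinarith
  have hsub : 0 < 1 - √eps := sub_pos.2 hs1
  have hadd : 0 < 1 + √eps := by linarith
  have hminus : 1 - aminus ^ 2 = 2 * √eps / (1 + √eps) := by
    have h : aminus ^ 2 = (1 - √eps) / (1 + √eps) := by
      simp only [aminus]
      rw [div_pow, div_eq_div_iff (by positivity) hadd.ne']
      linear_combination (-(1 - √eps)) * hsq
    rw [h]
    field_simp
    ring
  have hplus : 1 - aplus ^ 2 = -(2 * √eps) / (1 - √eps) := by
    have h : aplus ^ 2 = (1 + √eps) / (1 - √eps) := by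
      simp only [aplus]
      rw [div_pow, div_eq_div_iff (by positivity) hsub.ne']
      linear_combination (-(1 + √eps)) * hsq
    rw [h, eq_div_iff hsub.ne', sub_mul, div_mul_cancel₀ _ hsub.ne']
    ring
  have hminus_pos : 0 < 1 - aminus ^ 2 := by
    rw [hminus]
    positivity
  have hplus_neg : 1 - aplus ^ 2 < 0 := by
    rw [hplus]
    exact div_neg_of_neg_of_pos (by linarith) hsub
  have hap : 0 < aplus := by positivity
  have ham : 0 < aminus := div_pos hsub (by positivity)
  exact ⟨heps, hminus, hplus, hminus_pos, hplus_neg, ham, by nlinarith, by nlinarith⟩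
end

section
/- Let g be real with g > 1/2, set s = √(4g² - 1) > 0 and a± = (1 ± i s)/(2g) ∈ ℂ. Then the mass eigenvalues are Λ± = 1 - a±² = (2s² ∓ 2is)/(1 + s²); in particular Re(Λ₊) = Re(Λ₋) = 2s²/(1 + s²) > 0, so in the broken phase both families of diagonal fluctuation modes are stable. -/
theorem one_sub_sq_one_add_I_mul_div {g t : ℝ} (h : 4 * g ^ 2 = 1 + t ^ 2) :
    1 - ((1 + Complex.I * (t : ℂ)) / (2 * g)) ^ 2 =
      (2 * (t : ℂ) ^ 2 - 2 * Complex.I * (t : ℂ)) / (1 + (t : ℂ) ^ 2) := by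
  have hc : (2 * (g : ℂ)) ^ 2 = 1 + (t : ℂ) ^ 2 := by
    rw [mul_pow]
    norm_num
    exact_mod_cast h
  have hne : (1 : ℂ) + (t : ℂ) ^ 2 ≠ 0 := by
    exact_mod_cast (by positivity : (1 : ℝ) + t ^ 2 ≠ 0)
  rw [div_pow, hc, eq_div_iff hne, sub_mul, div_mul_cancel₀ _ hne]
  linear_combination (-(t : ℂ) ^ 2) * Complex.I_sq

theorem re_one_sub_sq_one_add_I_mul_div {g t : ℝ} (h : 4 * g ^ 2 = 1 + t ^ 2) :
    (1 - ((1 + Complex.I * (t : ℂ)) / (2 * g)) ^ 2).re = 2 * t ^ 2 / (1 + t ^ 2) := by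
  have hd : (1 : ℂ) + (t : ℂ) ^ 2 = ((1 + t ^ 2 : ℝ) : ℂ) := by push_cast; rfl
  rw [one_sub_sq_one_add_I_mul_div h, hd, Complex.div_ofReal_re]
  simp [← Complex.ofReal_pow]


/-- For `g > 1/2`, `s = √(4g² - 1) > 0` and `a± = (1 ± is)/(2g)`,
the mass eigenvalues are `Λ± = 1 - a±² = (2s² ∓ 2is)/(1 + s²)`; in particular
`Re(Λ₊) = Re(Λ₋) = 2s²/(1 + s²) > 0`: both families of diagonal fluctuation
modes are stable in the broken phase. -/
theorem broken_phase_stability (g : ℝ) (hg : 1/2 < g) :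
    let s : ℝ := Real.sqrt (4 * g ^ 2 - 1)
    let aplus : ℂ := (1 + Complex.I * (s : ℂ)) / (2 * g)
    let aminus : ℂ := (1 - Complex.I * (s : ℂ)) / (2 * g)
    0 < s ∧
    1 - aplus ^ 2 = (2 * (s : ℂ) ^ 2 - 2 * Complex.I * (s : ℂ)) / (1 + (s : ℂ) ^ 2) ∧
    1 - aminus ^ 2 = (2 * (s : ℂ) ^ 2 + 2 * Complex.I * (s : ℂ)) / (1 + (s : ℂ) ^ 2) ∧
    (1 - aplus ^ 2).re = 2 * s ^ 2 / (1 + s ^ 2) ∧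
    (1 - aminus ^ 2).re = 2 * s ^ 2 / (1 + s ^ 2) ∧
    0 < (1 - aplus ^ 2).re ∧ 0 < (1 - aminus ^ 2).re := by
  intro s aplus aminus
  have hpos : 0 < 4 * g ^ 2 - 1 := by nlinarith
  have hs : 0 < s := Real.sqrt_pos.mpr hpos
  have hsq : s ^ 2 = 4 * g ^ 2 - 1 := Real.sq_sqrt hpos.le
  have hplus : 4 * g ^ 2 = 1 + s ^ 2 := by linarith
  have hminus : 4 * g ^ 2 = 1 + (-s) ^ 2 := by rw [neg_sq]; exact hplus
  have haminus : aminus = (1 + Complex.I * ((-s : ℝ) : ℂ)) / (2 * g) := by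
    simp only [aminus, Complex.ofReal_neg, mul_neg, sub_eq_add_neg]
  have hre_plus : (1 - aplus ^ 2).re = 2 * s ^ 2 / (1 + s ^ 2) :=
    re_one_sub_sq_one_add_I_mul_div hplus
  have hre_minus : (1 - aminus ^ 2).re = 2 * s ^ 2 / (1 + s ^ 2) := by
    rw [haminus, re_one_sub_sq_one_add_I_mul_div hminus, neg_sq]
  have hre_pos : 0 < 2 * s ^ 2 / (1 + s ^ 2) := by positivity
  refine ⟨hs, one_sub_sq_one_add_I_mul_div hplus, ?_, hre_plus, hre_minus,
    hre_plus ▸ hre_pos, hre_minus ▸ hre_pos⟩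
  rw [haminus, one_sub_sq_one_add_I_mul_div hminus]
  simp only [Complex.ofReal_neg, neg_sq, mul_neg, sub_neg_eq_add]
end

section
/- Let D ≥ 3 be an integer and k an integer. The set of tuples (E₊, E₋, V₊, V₋, V₊₋, C₊, C₋, g₊, g₋) of nonnegative integers satisfying 2E₊ ≥ 3V₊, 2E₋ ≥ 3V₋, V₊₋ ≤ E₊ + E₋ + 1, C₊ ≤ V₊ + V₊₋, C₋ ≤ V₋ + V₊₋, C₊ + C₋ ≤ V₊₋ + 1, and whose scaling exponent ω = -(D-2)(E₊ - V₊) - (D-2)(E₋ - V₋) + 2 - 2(V₊₋ - C₊ - C₋ + 1) - 2g₊ - 2g₋ equals k, is finite. (This is the combinatorial content of the theorem that for D ≥ 3 the number of graphs at fixed order in 1/N is finite.) -/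
/-- For `D ≥ 3` and any integer `k`, the set of tuples
`(E₊, E₋, V₊, V₋, V₊₋, C₊, C₋, g₊, g₋)` of nonnegative integers satisfying the
combinatorial constraints of a connected Feynman graph and whose scaling
exponent `ω` equals `k` is finite: for `D ≥ 3` the number of graphs at fixed
order in `1/N` is finite. -/
theorem finitely_many_graphs_at_fixed_order (D : ℕ) (hD : 3 ≤ D) (k : ℤ) :
    Set.Finite {t : ℕ × ℕ × ℕ × ℕ × ℕ × ℕ × ℕ × ℕ × ℕ |
      match t with
      | (Ep, Em, Vp, Vm, Vpm, Cp, Cm, gp, gm) =>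
        3 * Vp ≤ 2 * Ep ∧ 3 * Vm ≤ 2 * Em ∧ Vpm ≤ Ep + Em + 1 ∧
        Cp ≤ Vp + Vpm ∧ Cm ≤ Vm + Vpm ∧ Cp + Cm ≤ Vpm + 1 ∧
        -(((D : ℤ) - 2)) * ((Ep : ℤ) - Vp) - ((D : ℤ) - 2) * ((Em : ℤ) - Vm)
          + 2 - 2 * ((Vpm : ℤ) - Cp - Cm + 1) - 2 * gp - 2 * gm = k} := by
  obtain ⟨d, rfl⟩ := Nat.exists_eq_add_of_le hD
  obtain ⟨B, hB⟩ : ∃ B : ℕ, B = 3 * (2 - k).toNat + 2 := ⟨_, rfl⟩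
  refine (Set.finite_Iic (B, B, B, B, B, B, B, B, B)).subset ?_
  rintro ⟨Ep, Em, Vp, Vm, Vpm, Cp, Cm, gp, gm⟩ ⟨hp, hm, hpm, hCp, hCm, hC, hω⟩
  have h₁ : 0 ≤ (d : ℤ) * ((Ep : ℤ) - Vp) := mul_nonneg (by positivity) (by omega)
  have h₂ : 0 ≤ (d : ℤ) * ((Em : ℤ) - Vm) := mul_nonneg (by positivity) (by omega)
  have h₃ : ((Ep : ℤ) - Vp) + ((Em : ℤ) - Vm) + 2 * ((Vpm : ℤ) - Cp - Cm + 1)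
      + 2 * gp + 2 * gm ≤ 2 - k := by
    push_cast at hω
    linarith
  simp only [Set.mem_Iic, Prod.mk_le_mk]
  omega
end

section
/- Let D ≥ 3 be an integer and let E₊, E₋, V₊, V₋, V₊₋, C₊, C₋, g₊, g₋ be nonnegative integers with V₋ ≥ 1, satisfying 2E₊ ≥ 3V₊, 2E₋ ≥ 3(V₋ - 1) + 1, and V₊₋ - C₊ - C₋ + 1 ≥ 0. Then the one-point-function scaling exponent ω' = -D - (D-2)(E₊ - V₊) - (D-2)(E₋ - V₋) + 2 - 2(V₊₋ - C₊ - C₋ + 1) - 2g₊ - 2g₋ satisfies 3ω' ≤ -(D-2)(E₊ + E₋ + 1). Consequently the connected one-point function ⟨(1/N)Tr[M₋]⟩ is of order N^{-(D-2)/3} for D ≥ 3. -/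
/-- For `D ≥ 3` and nonnegative graph data of a connected
one-point-function graph (`V₋ ≥ 1` counts the extra univalent `−` vertex, so
`2E₋ ≥ 3(V₋-1) + 1`, while `2E₊ ≥ 3V₊` and connectivity gives
`V₊₋ - C₊ - C₋ + 1 ≥ 0`), the one-point scaling exponent
`ω' = -D - (D-2)(E₊-V₊) - (D-2)(E₋-V₋) + 2 - 2(V₊₋-C₊-C₋+1) - 2g₊ - 2g₋`
satisfies `3ω' ≤ -(D-2)(E₊+E₋+1)`: the connected one-point function
`⟨(1/N)Tr[M₋]⟩` is of order `N^{-(D-2)/3}` for `D ≥ 3`. -/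
theorem one_point_function_scaling_bound (D : ℕ) (hD : 3 ≤ D)
    (Ep Em Vp Vm Vpm Cp Cm gp gm : ℕ) (hVm1 : 1 ≤ Vm)
    (hVp : 3 * Vp ≤ 2 * Ep) (hVm : 3 * (Vm - 1) + 1 ≤ 2 * Em)
    (hconn : (0 : ℤ) ≤ (Vpm : ℤ) - Cp - Cm + 1) :
    3 * (-(D : ℤ) - ((D : ℤ) - 2) * ((Ep : ℤ) - Vp) - ((D : ℤ) - 2) * ((Em : ℤ) - Vm)
        + 2 - 2 * ((Vpm : ℤ) - Cp - Cm + 1) - 2 * gp - 2 * gm)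
      ≤ -(((D : ℤ) - 2)) * ((Ep : ℤ) + Em + 1) := by
  have hd : (0 : ℤ) ≤ (D : ℤ) - 2 := by omega
  have hV : (0 : ℤ) ≤ 2 * ((Ep : ℤ) + Em + 1) - 3 * (Vp + Vm) := by omega
  have hgp : (0 : ℤ) ≤ gp := Int.natCast_nonneg gp
  have hgm : (0 : ℤ) ≤ gm := Int.natCast_nonneg gm
  linear_combination mul_nonneg hd hV + 6 * hconn + 6 * hgp + 6 * hgm
end
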